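/- Let M be a sharp toric monoid and suppose M = N ⊕ K for faces N and K, i.e. the addition map N × K → M is bijective. Then the ideal (N⁺) = N⁺ + M generated by N⁺ = N ∖ {0} coincides with M ∖ K, it is a prime ideal of M, and its height equals rk(N). -/

import Mathlib

open scoped TensorProduct Pointwise

/-- The rank of an abelian group `A`, i.e. `dim_ℚ (A ⊗_ℤ ℚ)`, for a subgroup of an ambient
abelian group. -/
noncomputable def grpRank {G : Type*} [AddCommGroup G] (A : AddSubgroup G) : ℕ :=
  Module.finrank ℚ (ℚ ⊗[ℤ] A)

variable {Λ : Type*} [AddCommGroup Λ]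

/-- The rank of the subgroup generated by a subset `S` of `Λ`. -/
noncomputable def setRank (S : Set Λ) : ℕ :=
  grpRank (AddSubgroup.closure S)

/-- The rank of a submonoid `M` of `Λ`; when `Λ = M^gp` this is `rk M = dim_ℚ(M^gp ⊗ ℚ)`. -/
noncomputable def monRank (M : AddSubmonoid Λ) : ℕ :=
  setRank (M : Set Λ)

/-- A toric monoid, presented as a submonoid `M` of an abelian group `Λ` which plays the role
of `M^gp`: `M` is finitely generated (hence fine, being cancellative as a submonoid of a
group), `M` generates `Λ` as a group (so that `Λ = M^gp`), `Λ` is torsion free, and `M`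
is saturated in `Λ`. -/
def IsToric (M : AddSubmonoid Λ) : Prop :=
  M.FG ∧ AddSubgroup.closure (M : Set Λ) = ⊤ ∧
    (∀ (x : Λ) (n : ℕ), 0 < n → n • x = 0 → x = 0) ∧
    (∀ (x : Λ) (n : ℕ), 0 < n → n • x ∈ M → x ∈ M)

/-- `M` is sharp: `0` is its only unit. -/
def IsSharp (M : AddSubmonoid Λ) : Prop :=
  ∀ x ∈ M, ∀ y ∈ M, x + y = 0 → x = 0

/-- An ideal of the monoid `M`: a subset `I ⊆ M` with `I + M ⊆ I`. -/
def IsMonIdeal (M : AddSubmonoid Λ) (I : Set Λ) : Prop :=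
  I ⊆ (M : Set Λ) ∧ ∀ i ∈ I, ∀ m ∈ M, i + m ∈ I

/-- A prime ideal of the monoid `M`: an ideal `p ≠ M` such that `x + y ∈ p` implies `x ∈ p` or
`y ∈ p`.  The empty set counts as a prime ideal. -/
def IsPrimeMonIdeal (M : AddSubmonoid Λ) (p : Set Λ) : Prop :=
  IsMonIdeal M p ∧ p ≠ (M : Set Λ) ∧ ∀ x ∈ M, ∀ y ∈ M, x + y ∈ p → x ∈ p ∨ y ∈ p

/-- The height of a prime ideal `p` of `M`: the supremum (in `ℕ∞`) of the lengths `n` of chains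
`p₀ ⊊ p₁ ⊊ ⋯ ⊊ pₙ = p` of prime ideals of `M`. -/
noncomputable def primeHeight (M : AddSubmonoid Λ) (p : Set Λ) : ℕ∞ :=
  sSup {n : ℕ∞ | ∃ m : ℕ, n = (m : ℕ∞) ∧ ∃ c : Fin (m + 1) → Set Λ,
    (∀ i, IsPrimeMonIdeal M (c i)) ∧ StrictMono c ∧ c (Fin.last m) = p}

/-- A face of the monoid `M`: a submonoid `F ⊆ M` such that `x + y ∈ F` implies `x ∈ F` and
`y ∈ F` for `x, y ∈ M`. -/
def IsFace (M : AddSubmonoid Λ) (F : Set Λ) : Prop :=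
  F ⊆ (M : Set Λ) ∧ 0 ∈ F ∧ (∀ x ∈ F, ∀ y ∈ F, x + y ∈ F) ∧
    ∀ x ∈ M, ∀ y ∈ M, x + y ∈ F → x ∈ F ∧ y ∈ F

/-- A facet of `M`: a face of rank `rk(M) - 1`. -/
def IsFacet (M : AddSubmonoid Λ) (F : Set Λ) : Prop :=
  IsFace M F ∧ (setRank F : ℤ) = (monRank M : ℤ) - 1

/-- An edge of `M`: a face of rank `1`. -/
def IsEdge (M : AddSubmonoid Λ) (E : Set Λ) : Prop :=
  IsFace M E ∧ setRank E = 1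

/-- The face `N` splits off from `M`: there is a face `K` such that the addition map
`N × K → M` is bijective. -/
def SplitsOff (M : AddSubmonoid Λ) (N : Set Λ) : Prop :=
  ∃ K : Set Λ, IsFace M K ∧
    (∀ m ∈ M, ∃ a ∈ N, ∃ b ∈ K, m = a + b) ∧
    (∀ a ∈ N, ∀ b ∈ K, ∀ a' ∈ N, ∀ b' ∈ K, a + b = a' + b' → a = a' ∧ b = b')

/-- The **Farkas lemma** over an ordered field: a vector on which every functional nonnegative on a
finite family is nonnegative is a nonnegative combination of the family. -/
theorem exists_nonneg_sum_of_dual_nonneg {k V I : Type*} [Field k] [LinearOrder k]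
    [IsStrictOrderedRing k] [AddCommGroup V] [Module k V] (s : Finset I) (v : I → V) (b : V)
    (h : ∀ f : Module.Dual k V, (∀ i ∈ s, 0 ≤ f (v i)) → 0 ≤ f b) :
    ∃ c : I → k, (∀ i ∈ s, 0 ≤ c i) ∧ b = ∑ i ∈ s, c i • v i := by
  classical
  induction s using Finset.induction_on generalizing v b with
  | empty =>
    refine ⟨0, by simp, ?_⟩
    have hb : ∀ f : Module.Dual k V, f b = 0 := fun f => by
      have h₁ := h f (by simp)
      have h₂ := h (-f) (by simp)
      simp only [LinearMap.neg_apply] at h₂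
      linarith
    simpa using (Module.forall_dual_apply_eq_zero_iff k b).1 hb
  | insert a s ha ih =>
    by_cases hs : ∀ f : Module.Dual k V, (∀ i ∈ s, 0 ≤ f (v i)) → 0 ≤ f b
    · obtain ⟨c, hc, hb⟩ := ih v b hs
      refine ⟨fun i => if i = a then 0 else c i, ?_, ?_⟩
      · intro i hi
        by_cases hia : i = a
        · simp [hia]
        · simpa [hia] using hc i (Finset.mem_of_mem_insert_of_ne hi hia)
      · rw [Finset.sum_insert ha, hb]
        simp only [if_true, zero_smul, zero_add]
        refine Finset.sum_congr rfl fun i hi => ?_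
        rw [if_neg (ne_of_mem_of_not_mem hi ha)]
    · push Not at hs
      obtain ⟨f, hf, hfb⟩ := hs
      have hfa : f (v a) < 0 := by
        by_contra! hfa
        exact absurd (h f (by simpa [hfa] using hf)) (not_le.2 hfb)
      set g : Module.Dual k V := (-(f (v a))⁻¹) • f with hg
      have hinv : 0 < -(f (v a))⁻¹ := neg_pos.2 (inv_lt_zero.2 hfa)
      have hga : g (v a) = -1 := by
        simp [hg, inv_mul_cancel₀ hfa.ne]
      have hgs : ∀ i ∈ s, 0 ≤ g (v i) := fun i hi => mul_nonneg hinv.le (hf i hi)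
      have hgb : g b < 0 := mul_neg_of_pos_of_neg hinv hfb
      obtain ⟨c, hc, hb⟩ := ih (fun i => v i + g (v i) • v a) (b + g b • v a) (by
        intro e he
        have := h (e + e (v a) • g) (by
          intro i hi
          rcases Finset.mem_insert.1 hi with rfl | hi
          · simp [hga]
          · have := he i hi
            simp only [map_add, map_smul, smul_eq_mul] at this
            simp only [LinearMap.add_apply, LinearMap.smul_apply, smul_eq_mul]
            linarith)
        simp only [LinearMap.add_apply, LinearMap.smul_apply, smul_eq_mul] at this
        simp only [map_add, map_smul, smul_eq_mul]
        linarith)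
      refine ⟨fun i => if i = a then ∑ j ∈ s, c j * g (v j) - g b else c i, ?_, ?_⟩
      · intro i hi
        by_cases hia : i = a
        · have := Finset.sum_nonneg fun j hj => mul_nonneg (hc j hj) (hgs j hj)
          simp only [hia, if_true]
          linarith
        · simpa [hia] using hc i (Finset.mem_of_mem_insert_of_ne hi hia)
      · rw [Finset.sum_insert ha]
        have hsum : ∑ i ∈ s, (if i = a then ∑ j ∈ s, c j * g (v j) - g b else c i) • v i =
            ∑ i ∈ s, c i • v i := Finset.sum_congr rfl fun i hi => by
          rw [if_neg (ne_of_mem_of_not_mem hi ha)]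
        rw [hsum]
        beta_reduce
        rw [if_pos rfl]
        simp only [smul_add, Finset.sum_add_distrib, smul_smul, ← Finset.sum_smul] at hb
        refine (eq_sub_of_add_eq hb).trans ?_
        rw [sub_smul]
        abel

theorem setRank_eq_finrank_span (S : Set Λ) :
    setRank S = Module.finrank ℚ
      (Submodule.span ℚ ((TensorProduct.mk ℤ ℚ Λ 1) '' S)) := by
  have h := (Submodule.toBaseChange.toLinearEquiv ℚ
    (AddSubgroup.toIntSubmodule (AddSubgroup.closure S))).finrank_eq
  have h' : Submodule.baseChange ℚ (AddSubgroup.toIntSubmodule (AddSubgroup.closure S)) =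
      Submodule.span ℚ ((TensorProduct.mk ℤ ℚ Λ 1) '' S) := by
    rw [← Submodule.span_int_eq_addSubgroupClosure, Submodule.toAddSubgroup_toIntSubmodule,
      Submodule.baseChange_span]
  rw [h'] at h
  exact h

theorem mk_one_injective (h : ∀ (x : Λ) (n : ℕ), 0 < n → n • x = 0 → x = 0) :
    Function.Injective (TensorProduct.mk ℤ ℚ Λ 1) := by
  have : Module.IsTorsionFree ℤ Λ := by
    refine .of_smul_eq_zero fun r x hr => ?_
    by_contra! hne
    refine hne.2 (h x r.natAbs (Int.natAbs_pos.2 hne.1) ?_)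
    rcases Int.natAbs_eq r with h | h <;> rw [h] at hr <;> simpa using hr
  have hflat := Module.Flat.rTensor_preserves_injective_linearMap (M := Λ)
    (Algebra.linearMap ℤ ℚ) (by intro a b; simp)
  have := hflat.comp (TensorProduct.lid ℤ Λ).symm.injective
  convert this using 1
  ext x
  simp

section Faces

variable {V : Type*} [AddCommGroup V] [Module ℚ V] {M : AddSubmonoid Λ} {F G K : Set Λ}

theorem IsFace.nsmul_mem (hF : IsFace M F) {x : Λ} (hx : x ∈ F) (n : ℕ) : n • x ∈ F := by
  induction n with
  | zero => simpa using hF.2.1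
  | succ n ih => simpa [succ_nsmul] using hF.2.2.1 _ ih _ hx

theorem IsFace.mem_of_nsmul_mem (hF : IsFace M F) {x : Λ} (hx : x ∈ M) {n : ℕ} (hn : 0 < n)
    (h : n • x ∈ F) : x ∈ F := by
  obtain ⟨n, rfl⟩ := Nat.exists_eq_succ_of_ne_zero hn.ne'
  rw [succ_nsmul] at h
  exact (hF.2.2.2 _ (M.nsmul_mem hx n) _ hx h).2

/-- A face is generated by the generators of the monoid that it contains. -/
theorem IsFace.subset_closure (hF : IsFace M F) {T : Set Λ} (hT : AddSubmonoid.closure T = M) :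
    F ⊆ AddSubmonoid.closure (T ∩ F) := by
  intro x hx
  have hxM : x ∈ AddSubmonoid.closure T := hT ▸ hF.1 hx
  induction hxM using AddSubmonoid.closure_induction with
  | mem x h => exact AddSubmonoid.subset_closure ⟨h, hx⟩
  | zero => exact zero_mem _
  | add x y hx' hy' ihx ihy =>
    have := hF.2.2.2 x (hT ▸ hx') y (hT ▸ hy') hx
    exact add_mem (ihx this.1) (ihy this.2)

/-- An element of the rational span of a face is, up to a positive multiple, a difference of two
elements of the face. -/
theorem IsFace.exists_nsmul_eq_sub (hF : IsFace M F) (φ : Λ →+ V) {v : V}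
    (hv : v ∈ Submodule.span ℚ (φ '' F)) :
    ∃ n : ℕ, 0 < n ∧ ∃ a ∈ F, ∃ b ∈ F, n • v = φ a - φ b := by
  induction hv using Submodule.span_induction with
  | mem x h =>
    obtain ⟨a, ha, rfl⟩ := h
    exact ⟨1, one_pos, a, ha, 0, hF.2.1, by simp⟩
  | zero => exact ⟨1, one_pos, 0, hF.2.1, 0, hF.2.1, by simp⟩
  | add x y _ _ hx hy =>
    obtain ⟨n, hn, a, ha, b, hb, h⟩ := hx
    obtain ⟨m, hm, c, hc, d, hd, h'⟩ := hy
    refine ⟨n * m, Nat.mul_pos hn hm, m • a + n • c,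
      hF.2.2.1 _ (hF.nsmul_mem ha m) _ (hF.nsmul_mem hc n), m • b + n • d,
      hF.2.2.1 _ (hF.nsmul_mem hb m) _ (hF.nsmul_mem hd n), ?_⟩
    have h₁ : (n * m) • (x + y) = m • (n • x) + n • (m • y) := by
      rw [smul_add, mul_smul, mul_smul, smul_comm n m x]
    rw [h₁, h, h']
    simp only [map_add, map_nsmul, smul_sub]
    abel
  | smul q x _ hx =>
    obtain ⟨n, hn, a, ha, b, hb, h⟩ := hx
    have hq : (q.den * n) • (q • x) = q.num • (n • x) := by
      rw [mul_comm, mul_smul, ← Nat.cast_smul_eq_nsmul ℚ q.den (q • x), smul_smul,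
        Rat.den_mul_eq_num, Int.cast_smul_eq_zsmul, smul_comm]
    rcases Int.natAbs_eq q.num with hk | hk
    · refine ⟨q.den * n, Nat.mul_pos q.den_pos hn, _, hF.nsmul_mem ha q.num.natAbs, _,
        hF.nsmul_mem hb q.num.natAbs, ?_⟩
      rw [hq, h, hk, natCast_zsmul, map_nsmul, map_nsmul, smul_sub, Int.natAbs_natCast]
    · refine ⟨q.den * n, Nat.mul_pos q.den_pos hn, _, hF.nsmul_mem hb q.num.natAbs, _,
        hF.nsmul_mem ha q.num.natAbs, ?_⟩
      rw [hq, h, hk, neg_smul, natCast_zsmul, map_nsmul, map_nsmul, ← smul_neg, neg_sub, smul_sub,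
        Int.natAbs_neg, Int.natAbs_natCast]

theorem exists_nsmul_sum_eq (φ : Λ →+ V) (s : Finset Λ) (c : Λ → ℚ) (hs : ∀ x ∈ s, x ∈ M)
    (hc : ∀ x ∈ s, 0 ≤ c x) :
    ∃ n : ℕ, 0 < n ∧ ∃ p ∈ M, n • ∑ x ∈ s, c x • φ x = φ p := by
  classical
  induction s using Finset.induction_on with
  | empty => exact ⟨1, one_pos, 0, zero_mem _, by simp⟩
  | insert a s ha ih =>
    obtain ⟨n, hn, p, hp, h⟩ := ih (fun x hx => hs x (Finset.mem_insert_of_mem hx))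
      (fun x hx => hc x (Finset.mem_insert_of_mem hx))
    have hca := hc a (Finset.mem_insert_self _ _)
    have haM := hs a (Finset.mem_insert_self _ _)
    refine ⟨(c a).den * n, Nat.mul_pos (c a).den_pos hn,
      n • ((c a).num.toNat • a) + (c a).den • p,
      add_mem (M.nsmul_mem (M.nsmul_mem haM _) _) (M.nsmul_mem hp _), ?_⟩
    have hq : (c a).den • (c a • φ a) = (c a).num.toNat • φ a := by
      rw [← Nat.cast_smul_eq_nsmul ℚ (c a).den, smul_smul, Rat.den_mul_eq_num,
        Int.cast_smul_eq_zsmul, ← natCast_zsmul, Int.toNat_of_nonneg (Rat.num_nonneg.2 hca)]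
    rw [Finset.sum_insert ha, smul_add, mul_smul _ _ (∑ x ∈ s, _), h, mul_comm, mul_smul, hq]
    simp

/-- Every element outside a face `K` is separated from `K` by a functional which is nonnegative on
the monoid and vanishes on `K`. -/
theorem IsFace.exists_dual_pos (hK : IsFace M K) (φ : Λ →+ V) (hφ : Function.Injective φ)
    {T : Finset Λ} (hT : AddSubmonoid.closure (T : Set Λ) = M) {t : Λ} (ht : t ∈ M)
    (htK : t ∉ K) :
    ∃ f : Module.Dual ℚ V, (∀ x ∈ M, 0 ≤ f (φ x)) ∧ (∀ x ∈ K, f (φ x) = 0) ∧ 0 < f (φ t) := by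
  by_contra! hne
  set W := Submodule.span ℚ (φ '' K) with hW
  obtain ⟨c, hc, hb⟩ := exists_nonneg_sum_of_dual_nonneg (k := ℚ) T
    (fun x => W.mkQ (φ x)) (-W.mkQ (φ t)) (by
      intro f hf
      have := hne (f ∘ₗ W.mkQ) (by
        intro x hx
        rw [← hT] at hx
        induction hx using AddSubmonoid.closure_induction with
        | mem x h => exact hf x h
        | zero => simp
        | add x y _ _ hx hy => simpa using add_nonneg hx hy) (by
        intro x hx
        have : W.mkQ (φ x) = 0 := by
          simpa using Submodule.subset_span (Set.mem_image_of_mem φ hx)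
        rw [LinearMap.comp_apply, this, map_zero])
      simpa using this)
  have hTM : ∀ x ∈ T, x ∈ M := fun x hx => hT ▸ AddSubmonoid.subset_closure hx
  obtain ⟨n, hn, p, hp, h⟩ := exists_nsmul_sum_eq φ T c hTM hc
  have hmem : φ t + ∑ x ∈ T, c x • φ x ∈ W := by
    rw [← Submodule.Quotient.mk_eq_zero, ← Submodule.mkQ_apply, map_add, map_sum]
    simp only [map_smul]
    rw [← hb]
    simp
  obtain ⟨m, hm, a, ha, b, hb', h'⟩ := hK.exists_nsmul_eq_sub φ hmem
  have key : (n * m) • t + (m • p + n • b) = n • a := by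
    apply hφ
    have : φ (n • a) = n • (m • (φ t + ∑ x ∈ T, c x • φ x) + φ b) := by
      rw [h', map_nsmul]; simp
    rw [this]
    simp only [map_add, map_nsmul, smul_add, mul_smul, ← h]
    rw [smul_comm m n (∑ x ∈ T, c x • φ x)]
    abel
  have hKmem := hK.2.2.2 ((n * m) • t) (M.nsmul_mem ht _) (m • p + n • b)
    (add_mem (M.nsmul_mem hp _) (M.nsmul_mem (hK.1 hb') _)) (key ▸ hK.nsmul_mem ha n)
  exact htK (hK.mem_of_nsmul_mem ht (Nat.mul_pos hn hm) hKmem.1)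

theorem IsFace.finrank_span_lt [FiniteDimensional ℚ V] (hF : IsFace M F) (φ : Λ →+ V)
    (hφ : Function.Injective φ) (hFG : F ⊆ G) {x : Λ} (hxG : x ∈ G) (hxM : x ∈ M) (hxF : x ∉ F) :
    Module.finrank ℚ (Submodule.span ℚ (φ '' F)) <
      Module.finrank ℚ (Submodule.span ℚ (φ '' G)) := by
  refine Submodule.finrank_lt_finrank_of_lt (lt_of_le_of_ne
    (Submodule.span_mono (Set.image_mono hFG)) fun heq => hxF ?_)
  have hx : φ x ∈ Submodule.span ℚ (φ '' F) :=
    heq ▸ Submodule.subset_span (Set.mem_image_of_mem φ hxG)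
  obtain ⟨n, hn, a, ha, b, hb, h⟩ := hF.exists_nsmul_eq_sub φ hx
  have key : n • x + b = a := hφ (by simp [h])
  exact hF.mem_of_nsmul_mem hxM hn
    (hF.2.2.2 _ (M.nsmul_mem hxM n) _ (hF.1 hb) (key ▸ ha)).1

theorem IsFace.exists_dual_pos_of_forall (hK : IsFace M K) (φ : Λ →+ V)
    (hφ : Function.Injective φ) {T : Finset Λ} (hT : AddSubmonoid.closure (T : Set Λ) = M) :
    ∃ f : Module.Dual ℚ V, (∀ x ∈ K, f (φ x) = 0) ∧ ∀ t ∈ T, t ∉ K → 0 < f (φ t) := by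
  classical
  have hTM : ∀ x ∈ T, x ∈ M := fun x hx => hT ▸ AddSubmonoid.subset_closure hx
  have h : ∀ t : Λ, ∃ f : Module.Dual ℚ V, (∀ x ∈ M, 0 ≤ f (φ x)) ∧ (∀ x ∈ K, f (φ x) = 0) ∧
      (t ∈ M → t ∉ K → 0 < f (φ t)) := by
    intro t
    by_cases ht : t ∈ M ∧ t ∉ K
    · obtain ⟨f, h₁, h₂, h₃⟩ := hK.exists_dual_pos φ hφ hT ht.1 ht.2
      exact ⟨f, h₁, h₂, fun _ _ => h₃⟩
    · exact ⟨0, by simp, by simp, fun h₁ h₂ => absurd ⟨h₁, h₂⟩ ht⟩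
  choose f h₁ h₂ h₃ using h
  refine ⟨∑ t ∈ T, f t, fun x hx => ?_, fun t ht htK => ?_⟩
  · rw [LinearMap.sum_apply]
    exact Finset.sum_eq_zero fun t _ => h₂ t x hx
  · rw [LinearMap.sum_apply]
    exact Finset.sum_pos' (fun s _ => h₁ s t (hTM t ht)) ⟨t, ht, h₃ t (hTM t ht) htK⟩

/-- Between two faces whose ranks differ by at least two lies a face of intermediate rank. -/
theorem IsFace.exists_between [FiniteDimensional ℚ V] (hK : IsFace M K) (hF : IsFace M F)
    (hKF : K ⊆ F) (φ : Λ →+ V) (hφ : Function.Injective φ) (hM : M.FG)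
    (hlt : Module.finrank ℚ (Submodule.span ℚ (φ '' K)) + 1 <
      Module.finrank ℚ (Submodule.span ℚ (φ '' F))) :
    ∃ G, IsFace M G ∧ K ⊆ G ∧
      Module.finrank ℚ (Submodule.span ℚ (φ '' K)) <
        Module.finrank ℚ (Submodule.span ℚ (φ '' G)) ∧
      Module.finrank ℚ (Submodule.span ℚ (φ '' G)) <
        Module.finrank ℚ (Submodule.span ℚ (φ '' F)) := by
  classical
  obtain ⟨T, hT⟩ := hM
  have hTM : ∀ x ∈ T, x ∈ M := fun x hx => hT ▸ AddSubmonoid.subset_closure hx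
  obtain ⟨f, hfK, hfT⟩ := hK.exists_dual_pos_of_forall φ hφ hT
  obtain ⟨x, hxF, hxK⟩ : ∃ x ∈ F, x ∉ K := by
    by_contra! hle
    have : K = F := hKF.antisymm hle
    subst this
    omega
  -- a functional vanishing on `K` and at `x`, but negative somewhere on `F`
  obtain ⟨g, y, hyF, hgK, hgx, hgy⟩ : ∃ (g : Module.Dual ℚ V) (y : Λ), y ∈ F ∧
      (∀ z ∈ K, g (φ z) = 0) ∧ g (φ x) = 0 ∧ g (φ y) < 0 := by
    set U := Submodule.span ℚ (φ '' K) ⊔ Submodule.span ℚ {φ x} with hU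
    have hUrank : Module.finrank ℚ U < Module.finrank ℚ (Submodule.span ℚ (φ '' F)) := by
      have h₁ : Module.finrank ℚ U ≤ _ := Submodule.finrank_add_le_finrank_add_finrank
        (Submodule.span ℚ (φ '' K)) (Submodule.span ℚ {φ x})
      have h₂ : Module.finrank ℚ (Submodule.span ℚ {φ x}) ≤ 1 := by
        simpa using finrank_span_le_card (R := ℚ) {φ x}
      omega
    obtain ⟨y, hyF, hyU⟩ : ∃ y ∈ F, φ y ∉ U := by
      by_contra! hle
      have : Submodule.span ℚ (φ '' F) ≤ U := Submodule.span_le.2 (by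
        rintro _ ⟨y, hy, rfl⟩
        exact hle y hy)
      exact absurd (Submodule.finrank_mono this) (not_le.2 hUrank)
    obtain ⟨g, hgy, hgU⟩ := Submodule.exists_le_ker_of_notMem hyU
    have hgK : ∀ z ∈ K, g (φ z) = 0 := fun z hz =>
      hgU (Submodule.mem_sup_left (Submodule.subset_span (Set.mem_image_of_mem φ hz)))
    have hgx : g (φ x) = 0 := hgU (Submodule.mem_sup_right (Submodule.mem_span_singleton_self _))
    rcases lt_or_gt_of_ne hgy with h | h
    · exact ⟨g, y, hyF, hgK, hgx, h⟩
    · exact ⟨-g, y, hyF, by simpa using hgK, by simpa using hgx, by simpa using h⟩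
  -- functionals nonnegative on the generators of `F` are nonnegative on `F`
  have hnonneg : ∀ e : Module.Dual ℚ V, (∀ t ∈ T, t ∈ F → 0 ≤ e (φ t)) →
      ∀ z ∈ F, 0 ≤ e (φ z) := by
    intro e he z hz
    have := hF.subset_closure hT hz
    simp only [SetLike.mem_coe] at this
    induction this using AddSubmonoid.closure_induction with
    | mem z h => exact he z h.1 h.2
    | zero => simp
    | add z w h₁ h₂ hz' hw' =>
      have hz₁ : z ∈ M := hT ▸ AddSubmonoid.closure_mono Set.inter_subset_left h₁
      have hw₁ : w ∈ M := hT ▸ AddSubmonoid.closure_mono Set.inter_subset_left h₂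
      have := hF.2.2.2 z hz₁ w hw₁ hz
      simpa using add_nonneg (hz' this.1) (hw' this.2)
  obtain ⟨t₀, ht₀T, ht₀F, ht₀⟩ : ∃ t ∈ T, t ∈ F ∧ g (φ t) < 0 := by
    by_contra! hle
    exact absurd (hnonneg g hle y hyF) (not_le.2 hgy)
  have ht₀K : t₀ ∉ K := fun h => ht₀.ne (hgK _ h)
  obtain ⟨s, hs, hmin⟩ := Finset.exists_min_image (T.filter fun t => t ∈ F ∧ t ∉ K)
    (fun t => g (φ t) / f (φ t)) ⟨t₀, by simp [ht₀T, ht₀F, ht₀K]⟩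
  simp only [Finset.mem_filter] at hs hmin
  set c := g (φ s) / f (φ s) with hc
  have hc0 : c < 0 := lt_of_le_of_lt (hmin t₀ ⟨ht₀T, ht₀F, ht₀K⟩)
    (div_neg_of_neg_of_pos ht₀ (hfT _ ht₀T ht₀K))
  set e : Module.Dual ℚ V := g - c • f with he
  have heF : ∀ z ∈ F, 0 ≤ e (φ z) := hnonneg e fun t ht htF => by
    by_cases htK : t ∈ K
    · simp [he, hgK t htK, hfK t htK]
    · have := (le_div_iff₀ (hfT t ht htK)).1 (hmin t ⟨ht, htF, htK⟩)
      simpa [he] using this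
  have heK : ∀ z ∈ K, e (φ z) = 0 := fun z hz => by simp [he, hgK z hz, hfK z hz]
  have hes : e (φ s) = 0 := by
    simp [he, hc, div_mul_cancel₀ _ (hfT s hs.1 hs.2.2).ne']
  have hfx : 0 < f (φ x) := by
    by_contra! hle
    have hf0 : ∀ z ∈ F, 0 ≤ f (φ z) := hnonneg f fun t ht htF => by
      by_cases htK : t ∈ K
      · exact (hfK t htK).ge
      · exact (hfT t ht htK).le
    have hcl := hF.subset_closure hT hxF
    simp only [SetLike.mem_coe] at hcl
    refine hxK ?_
    clear hgx
    induction hcl using AddSubmonoid.closure_induction with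
    | mem z h =>
      by_contra hzK
      exact absurd (hfT z h.1 hzK) (not_lt.2 hle)
    | zero => exact hK.2.1
    | add z w h₁ h₂ hz hw =>
      have hz₁ : z ∈ M := hT ▸ AddSubmonoid.closure_mono Set.inter_subset_left h₁
      have hw₁ : w ∈ M := hT ▸ AddSubmonoid.closure_mono Set.inter_subset_left h₂
      obtain ⟨hzF, hwF⟩ := hF.2.2.2 z hz₁ w hw₁ hxF
      have h₃ := hf0 z hzF
      have h₄ := hf0 w hwF
      rw [map_add, map_add] at hle
      by_cases hzK : z ∈ K
      · by_cases hwK : w ∈ K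
        · exact hK.2.2.1 z hzK w hwK
        · exact absurd (hw hwF hwK (by linarith)) hwK
      · exact absurd (hz hzF hzK (by linarith)) hzK
  have hex : 0 < e (φ x) := by
    simpa [he, hgx] using mul_neg_of_neg_of_pos hc0 hfx
  have hG : IsFace M {z | z ∈ F ∧ e (φ z) = 0} := by
    refine ⟨fun z hz => hF.1 hz.1, ⟨hF.2.1, by simp⟩, fun z hz w hw =>
      ⟨hF.2.2.1 z hz.1 w hw.1, by simp [hz.2, hw.2]⟩, fun z hz w hw hzw => ?_⟩
    obtain ⟨hzF, hwF⟩ := hF.2.2.2 z hz w hw hzw.1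
    have h₁ := heF z hzF
    have h₂ := heF w hwF
    have h₃ := hzw.2
    rw [map_add, map_add] at h₃
    exact ⟨⟨hzF, by linarith⟩, hwF, by linarith⟩
  have hKG : K ⊆ {z | z ∈ F ∧ e (φ z) = 0} := fun z hz => ⟨hKF hz, heK z hz⟩
  exact ⟨_, hG, hKG, hK.finrank_span_lt φ hφ hKG ⟨hs.2.1, hes⟩ (hTM s hs.1) hs.2.2,
    hG.finrank_span_lt φ hφ (fun z hz => hz.1) hxF (hF.1 hxF) fun h => hex.ne' h.2⟩

theorem IsFace.exists_finrank_eq_succ [FiniteDimensional ℚ V] (hK : IsFace M K)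
    (φ : Λ →+ V) (hφ : Function.Injective φ) (hM : M.FG) (hF : IsFace M F) (hKF : K ⊆ F)
    (hlt : Module.finrank ℚ (Submodule.span ℚ (φ '' K)) <
      Module.finrank ℚ (Submodule.span ℚ (φ '' F))) :
    ∃ G, IsFace M G ∧ K ⊆ G ∧ Module.finrank ℚ (Submodule.span ℚ (φ '' G)) =
      Module.finrank ℚ (Submodule.span ℚ (φ '' K)) + 1 := by
  induction hn : Module.finrank ℚ (Submodule.span ℚ (φ '' F)) using Nat.strong_induction_on
    generalizing F with
  | _ n ih =>
    by_cases heq : Module.finrank ℚ (Submodule.span ℚ (φ '' F)) =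
        Module.finrank ℚ (Submodule.span ℚ (φ '' K)) + 1
    · exact ⟨F, hF, hKF, heq⟩
    · obtain ⟨G, hG, hKG, h₁, h₂⟩ := hK.exists_between hF hKF φ hφ hM (by omega)
      exact ih _ (hn ▸ h₂) hG hKG h₁ rfl

end Faces

theorem IsToric.moduleFinite {M : AddSubmonoid Λ} (hM : IsToric M) : Module.Finite ℤ Λ := by
  obtain ⟨T, hT⟩ := hM.1
  refine ⟨⟨T, ?_⟩⟩
  apply Submodule.toAddSubgroup_injective
  rw [Submodule.span_int_eq_addSubgroupClosure,
    Submodule.top_toAddSubgroup, eq_top_iff, ← hM.2.1, AddSubgroup.closure_le, ← hT]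
  exact AddSubmonoid.closure_le (S := (AddSubgroup.closure (T : Set Λ)).toAddSubmonoid).2
    AddSubgroup.subset_closure

section Toric

variable {M : AddSubmonoid Λ} {F G K N : Set Λ}

theorem IsFace.setRank_lt (hM : IsToric M) (hF : IsFace M F) (hG : G ⊆ M) (hFG : F ⊂ G) :
    setRank F < setRank G := by
  have := hM.moduleFinite
  obtain ⟨hle, x, hxG, hxF⟩ := Set.ssubset_iff_exists.1 hFG
  rw [setRank_eq_finrank_span, setRank_eq_finrank_span]
  exact hF.finrank_span_lt (TensorProduct.mk ℤ ℚ Λ 1).toAddMonoidHom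
    (mk_one_injective hM.2.2.1) hle hxG (hG hxG) hxF

theorem isFace_self (M : AddSubmonoid Λ) : IsFace M (M : Set Λ) :=
  ⟨subset_rfl, M.zero_mem, fun _ hx _ hy => M.add_mem hx hy, fun _ hx _ hy _ => ⟨hx, hy⟩⟩

theorem IsFace.exists_setRank_eq_succ (hM : IsToric M) (hK : IsFace M K)
    (hlt : setRank K < monRank M) :
    ∃ G, IsFace M G ∧ K ⊆ G ∧ setRank G = setRank K + 1 := by
  have := hM.moduleFinite
  simp only [monRank, setRank_eq_finrank_span] at hlt ⊢
  exact hK.exists_finrank_eq_succ (TensorProduct.mk ℤ ℚ Λ 1).toAddMonoidHom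
    (mk_one_injective hM.2.2.1) hM.1 (isFace_self M) hK.1 hlt

theorem IsFace.monRank_eq_add (hM : IsToric M) (hN : IsFace M N) (hK : IsFace M K)
    (hsurj : ∀ m ∈ M, ∃ a ∈ N, ∃ b ∈ K, m = a + b)
    (hinj : ∀ a ∈ N, ∀ b ∈ K, ∀ a' ∈ N, ∀ b' ∈ K, a + b = a' + b' → a = a' ∧ b = b') :
    monRank M = setRank N + setRank K := by
  have := hM.moduleFinite
  set φ : Λ →+ ℚ ⊗[ℤ] Λ := (TensorProduct.mk ℤ ℚ Λ 1).toAddMonoidHom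
  have hφ : Function.Injective φ := mk_one_injective hM.2.2.1
  have hrank : ∀ S : Set Λ, setRank S = Module.finrank ℚ (Submodule.span ℚ (φ '' S)) :=
    setRank_eq_finrank_span
  have hsup : Submodule.span ℚ (φ '' M) =
      Submodule.span ℚ (φ '' N) ⊔ Submodule.span ℚ (φ '' K) := by
    apply le_antisymm
    · rw [Submodule.span_le]
      rintro _ ⟨m, hm, rfl⟩
      obtain ⟨a, ha, b, hb, rfl⟩ := hsurj m hm
      rw [map_add]
      exact Submodule.add_mem_sup (Submodule.subset_span (Set.mem_image_of_mem φ ha))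
        (Submodule.subset_span (Set.mem_image_of_mem φ hb))
    · exact sup_le (Submodule.span_mono (Set.image_mono hN.1))
        (Submodule.span_mono (Set.image_mono hK.1))
  have hinf : Submodule.span ℚ (φ '' N) ⊓ Submodule.span ℚ (φ '' K) = ⊥ := by
    rw [Submodule.eq_bot_iff]
    rintro v ⟨hvN, hvK⟩
    obtain ⟨n, hn, a, ha, a', ha', h⟩ := hN.exists_nsmul_eq_sub φ hvN
    obtain ⟨m, hm, b, hb, b', hb', h'⟩ := hK.exists_nsmul_eq_sub φ hvK
    have key : m • a + n • b' = m • a' + n • b := by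
      apply hφ
      have h₁ : m • (φ a - φ a') = n • (φ b - φ b') := by rw [← h, ← h', smul_comm]
      rw [smul_sub, smul_sub, sub_eq_sub_iff_add_eq_add] at h₁
      simpa [add_comm] using h₁
    have hma := (hinj _ (hN.nsmul_mem ha m) _ (hK.nsmul_mem hb' n) _ (hN.nsmul_mem ha' m) _
      (hK.nsmul_mem hb n) key).1
    have hv : (m * n) • v = 0 := by
      rw [mul_smul, h, smul_sub, ← map_nsmul, ← map_nsmul, hma, sub_self]
    rw [← Nat.cast_smul_eq_nsmul ℚ] at hv
    exact (smul_eq_zero.1 hv).resolve_left (by positivity)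
  have := Submodule.finrank_sup_add_finrank_inf_eq (Submodule.span ℚ (φ '' N))
    (Submodule.span ℚ (φ '' K))
  rw [← hsup, hinf, finrank_bot, add_zero] at this
  rw [monRank, hrank, hrank, hrank, this]

theorem IsFace.isPrimeMonIdeal_diff (hF : IsFace M F) : IsPrimeMonIdeal M (M \ F) := by
  refine ⟨⟨Set.sdiff_subset, fun i hi m hm => ⟨M.add_mem hi.1 hm, fun h =>
    hi.2 (hF.2.2.2 i hi.1 m hm h).1⟩⟩, fun h => ?_, fun x hx y hy h => ?_⟩
  · exact (h.symm ▸ M.zero_mem : (0 : Λ) ∈ (M : Set Λ) \ F).2 hF.2.1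
  · by_contra! hne
    have hxF : x ∈ F := by_contra fun hxF => hne.1 ⟨hx, hxF⟩
    have hyF : y ∈ F := by_contra fun hyF => hne.2 ⟨hy, hyF⟩
    exact h.2 (hF.2.2.1 x hxF y hyF)

theorem IsPrimeMonIdeal.isFace_diff {p : Set Λ} (hp : IsPrimeMonIdeal M p) :
    IsFace M (M \ p) := by
  obtain ⟨⟨hpM, hadd⟩, hne, hprime⟩ := hp
  refine ⟨Set.sdiff_subset, ⟨M.zero_mem, fun h => hne (hpM.antisymm fun x hx => ?_)⟩,
    fun x hx y hy => ⟨M.add_mem hx.1 hy.1, fun h => ?_⟩, fun x hx y hy h =>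
    ⟨⟨hx, fun hxp => h.2 (hadd x hxp y hy)⟩, hy, fun hyp => h.2 (add_comm x y ▸ hadd y hyp x hx)⟩⟩
  · simpa using hadd 0 h x hx
  · exact (hprime x hx.1 y hy.1 h).elim hx.2 hy.2

/-- The height of the complement of a face `K` is the corank of `K`. -/
theorem IsFace.primeHeight_diff (hM : IsToric M) (hK : IsFace M K) :
    primeHeight M (M \ K) = ((monRank M - setRank K : ℕ) : ℕ∞) := by
  apply le_antisymm
  · refine sSup_le ?_
    rintro _ ⟨m, rfl, c, hc, hmono, hlast⟩
    have hbound : ∀ i : Fin (m + 1), setRank ((M : Set Λ) \ c i) + i ≤ monRank M := by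
      intro i
      induction i using Fin.induction with
      | zero =>
        rcases (Set.sdiff_subset (s := (M : Set Λ)) (t := c 0)).eq_or_ssubset with h | h
        · simp [h, monRank]
        · simpa [monRank] using ((hc 0).isFace_diff.setRank_lt hM subset_rfl h).le
      | succ i ih =>
        have hss : (M : Set Λ) \ c i.succ ⊂ (M : Set Λ) \ c i.castSucc := by
          obtain ⟨hle, x, hx, hx'⟩ := Set.ssubset_iff_exists.1 (hmono i.castSucc_lt_succ)
          exact Set.ssubset_iff_exists.2 ⟨Set.sdiff_subset_sdiff_right hle, x,
            ⟨(hc _).1.1 hx, hx'⟩, fun h => h.2 hx⟩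
        have := (hc i.succ).isFace_diff.setRank_lt hM Set.sdiff_subset hss
        simp only [Fin.val_succ, Fin.val_castSucc] at ih ⊢
        omega
    have := hbound (Fin.last m)
    rw [hlast, Set.sdiff_sdiff_cancel_left hK.1, Fin.val_last] at this
    exact_mod_cast (by omega : m ≤ monRank M - setRank K)
  · refine le_sSup ⟨_, rfl, ?_⟩
    set r := monRank M - setRank K with hr
    have hstep : ∀ F : {F : Set Λ // IsFace M F}, ∃ G : {F : Set Λ // IsFace M F},
        F.1 ⊆ G.1 ∧ (setRank F.1 < monRank M → setRank G.1 = setRank F.1 + 1) := by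
      intro F
      by_cases h : setRank F.1 < monRank M
      · obtain ⟨G, hG, hFG, hrk⟩ := F.2.exists_setRank_eq_succ hM h
        exact ⟨⟨G, hG⟩, hFG, fun _ => hrk⟩
      · exact ⟨F, subset_rfl, fun h' => absurd h' h⟩
    choose next hnext hrank using hstep
    set C : ℕ → {F : Set Λ // IsFace M F} := fun i => next^[i] ⟨K, hK⟩ with hC
    have hsucc : ∀ i, C (i + 1) = next (C i) := fun i => Function.iterate_succ_apply' ..
    have hCrank : ∀ i, i ≤ r → setRank (C i).1 = setRank K + i := by
      intro i hi
      induction i with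
      | zero => rfl
      | succ i ih =>
        have hi' := ih (by omega)
        rw [hsucc, hrank _ (by omega), hi', add_assoc]
    refine ⟨fun j => (M : Set Λ) \ (C (r - j)).1, fun j => (C _).2.isPrimeMonIdeal_diff,
      Fin.strictMono_iff_lt_succ.2 fun j => ?_, by simp [hC]⟩
    have hj : r - (j.castSucc : ℕ) = (r - (j.succ : ℕ)) + 1 := by
      simp only [Fin.val_castSucc, Fin.val_succ]
      omega
    have h₁ := hCrank (r - (j.succ : ℕ)) (by omega)
    have h₂ := hCrank (r - (j.castSucc : ℕ)) (by omega)
    have hss : (C (r - (j.succ : ℕ))).1 ⊂ (C (r - (j.castSucc : ℕ))).1 := by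
      refine ssubset_of_subset_of_ne ?_ fun h => ?_
      · rw [hj, hsucc]
        exact hnext _
      · rw [h, h₂] at h₁
        omega
    obtain ⟨hle, x, hx, hx'⟩ := Set.ssubset_iff_exists.1 hss
    exact Set.ssubset_iff_exists.2 ⟨Set.sdiff_subset_sdiff_right hle, x,
      ⟨(C _).2.1 hx, hx'⟩, fun h => h.2 hx⟩

end Toric

/-- Let `M` be a sharp toric monoid and suppose `M = N ⊕ K` for faces `N`
and `K` (the addition map `N × K → M` is bijective).  Then the ideal `(N⁺) = N⁺ + M`
coincides with `M ∖ K`, it is prime, and its height equals `rk(N)`. -/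
theorem statement8 (M : AddSubmonoid Λ) (hM : IsToric M) (hsharp : IsSharp M)
    (N K : Set Λ) (hN : IsFace M N) (hK : IsFace M K)
    (hsurj : ∀ m ∈ M, ∃ a ∈ N, ∃ b ∈ K, m = a + b)
    (hinj : ∀ a ∈ N, ∀ b ∈ K, ∀ a' ∈ N, ∀ b' ∈ K, a + b = a' + b' → a = a' ∧ b = b') :
    (N \ {0}) + (M : Set Λ) = (M : Set Λ) \ K ∧
    IsPrimeMonIdeal M ((N \ {0}) + (M : Set Λ)) ∧
    primeHeight M ((N \ {0}) + (M : Set Λ)) = (setRank N : ℕ∞) := by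
  have heq : (N \ {0}) + (M : Set Λ) = (M : Set Λ) \ K := by
    ext x
    constructor
    · rintro ⟨a, ⟨haN, ha0⟩, m, hm, rfl⟩
      refine ⟨M.add_mem (hN.1 haN) hm, fun h => ha0 ?_⟩
      have haK := (hK.2.2.2 a (hN.1 haN) m hm h).1
      exact (hinj a haN 0 hK.2.1 0 hN.2.1 a haK (by simp)).1
    · rintro ⟨hx, hxK⟩
      obtain ⟨a, ha, b, hb, rfl⟩ := hsurj x hx
      refine Set.add_mem_add ⟨ha, fun h => hxK ?_⟩ (hK.1 hb)
      rw [Set.mem_singleton_iff.1 h, zero_add]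
      exact hb
  refine ⟨heq, heq ▸ hK.isPrimeMonIdeal_diff, ?_⟩
  rw [heq, hK.primeHeight_diff hM, hN.monRank_eq_add hM hK hsurj hinj, Nat.add_sub_cancel]
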